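/- arXiv:1811.04194 — 2 statements merged into one kernel-verified Lean document; each statement's English description precedes it below -/
import Mathlib

section
/- Let E be a real inner product space and f : E → ℝ differentiable with L-Lipschitz gradient (L > 0). Assume f is τ-gradient dominated with global minimizer x* (τ > 0). Then for every x, v ∈ E, the step x⁺ = x − v/(2L) satisfies f(x⁺) − f(x*) ≤ (1 − 1/(4Lτ))·(f(x) − f(x*)) + (1/(4L))·‖v − ∇f(x)‖². -/
/-- The descent lemma: a function whose gradient is `L`-Lipschitz lies below its quadratic upper
model at every point. -/
theorem le_add_inner_add_of_lipschitz_gradient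
    {E : Type*} [NormedAddCommGroup E] [InnerProductSpace ℝ E]
    {f : E → ℝ} {f' : E → E} {L : ℝ}
    (hdiff : ∀ x, HasFDerivAt f (innerSL ℝ (f' x)) x)
    (hlip : ∀ x y, ‖f' x - f' y‖ ≤ L * ‖x - y‖) (x u : E) :
    f (x + u) ≤ f x + inner ℝ (f' x) u + L / 2 * ‖u‖ ^ 2 := by
  have hderiv : ∀ t : ℝ, HasDerivAt (fun t : ℝ => f (x + t • u))
      (inner ℝ (f' (x + t • u)) u) t := by
    intro t
    have hline : HasDerivAt (fun t : ℝ => x + t • u) u t := by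
      simpa using ((hasDerivAt_id t).smul_const u).const_add x
    exact (hdiff (x + t • u)).comp_hasDerivAt t hline
  have hmodel : ∀ t : ℝ, HasDerivAt
      (fun t : ℝ => f x + t * inner ℝ (f' x) u + L / 2 * ‖u‖ ^ 2 * t ^ 2)
      (inner ℝ (f' x) u + L * t * ‖u‖ ^ 2) t := by
    intro t
    have h := (((hasDerivAt_id t).mul_const (inner ℝ (f' x) u)).const_add (f x)).add
      ((hasDerivAt_pow 2 t).const_mul (L / 2 * ‖u‖ ^ 2))
    refine h.congr_deriv ?_
    push_cast
    ring
  have hbound : ∀ t ∈ Set.Ico (0 : ℝ) 1,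
      inner ℝ (f' (x + t • u)) u ≤ inner ℝ (f' x) u + L * t * ‖u‖ ^ 2 := by
    intro t ht
    have hcs := real_inner_le_norm (f' (x + t • u) - f' x) u
    have hl := hlip (x + t • u) x
    rw [add_sub_cancel_left, norm_smul, Real.norm_of_nonneg ht.1] at hl
    rw [inner_sub_left] at hcs
    have := mul_le_mul_of_nonneg_right hl (norm_nonneg u)
    linarith
  have h := image_le_of_deriv_right_le_deriv_boundary
    (fun t _ => (hderiv t).continuousAt.continuousWithinAt)
    (fun t _ => (hderiv t).hasDerivWithinAt) (by simp)
    (fun t _ => (hmodel t).continuousAt.continuousWithinAt)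
    (fun t _ => (hmodel t).hasDerivWithinAt) hbound (Set.right_mem_Icc.mpr zero_le_one)
  simpa using h

/-- Let `E` be a real inner product space and `f : E → ℝ`
differentiable with `L`-Lipschitz gradient `f'` (`L > 0`), and assume `f` is
`τ`-gradient dominated with global minimizer `x*` (`τ > 0`). Then for every
`x, v ∈ E`, the step `x⁺ = x − v/(2L)` satisfies
`f x⁺ − f x* ≤ (1 − 1/(4Lτ)) (f x − f x*) + (1/(4L)) ‖v − ∇f(x)‖²`. -/
theorem stmt_4
    {E : Type*} [NormedAddCommGroup E] [InnerProductSpace ℝ E]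
    (f : E → ℝ) (f' : E → E) (L τ : ℝ) (hL : 0 < L) (hτ : 0 < τ)
    (hdiff : ∀ x, HasFDerivAt f (innerSL ℝ (f' x)) x)
    (hlip : ∀ x y, ‖f' x - f' y‖ ≤ L * ‖x - y‖)
    (xstar : E) (hmin : ∀ y, f xstar ≤ f y)
    (hdom : ∀ x, f x - f xstar ≤ τ * ‖f' x‖ ^ 2)
    (x v : E) :
    f (x - (1 / (2 * L)) • v) - f xstar
      ≤ (1 - 1 / (4 * L * τ)) * (f x - f xstar)
        + (1 / (4 * L)) * ‖v - f' x‖ ^ 2 := by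
  have hdesc := le_add_inner_add_of_lipschitz_gradient hdiff hlip x (-((1 / (2 * L)) • v))
  rw [← sub_eq_add_neg, inner_neg_right, real_inner_smul_right, norm_neg, norm_smul,
    Real.norm_of_nonneg (by positivity)] at hdesc
  have hgap : 1 / (4 * L * τ) * (f x - f xstar) ≤ 1 / (4 * L) * ‖f' x‖ ^ 2 := by
    calc 1 / (4 * L * τ) * (f x - f xstar)
        ≤ 1 / (4 * L * τ) * (τ * ‖f' x‖ ^ 2) := by gcongr; exact hdom x
      _ = 1 / (4 * L) * ‖f' x‖ ^ 2 := by field_simp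
  have hquad : L / 2 * (1 / (2 * L) * ‖v‖) ^ 2 = 1 / (4 * L) * ‖v‖ ^ 2 / 2 := by
    field_simp
    ring
  have hhalf : 1 / (2 * L) * inner ℝ (f' x) v = 1 / (4 * L) * (2 * inner ℝ (f' x) v) := by
    field_simp
    ring
  have hnonneg : 0 ≤ 1 / (4 * L) * ‖v‖ ^ 2 := by positivity
  rw [norm_sub_sq_real, real_inner_comm]
  linarith
end

section
/- Let E be a real inner product space and f : E → ℝ differentiable with L-Lipschitz gradient (L > 0). Assume f is τ-gradient dominated with global minimizer x*, and that 4Lτ ≥ 1. Fix M_0 ≥ f(x_0) − f(x*) and a natural number q ≥ 4Lτ·log 4. Suppose a sequence of points y_0 = x_0, y_1, y_2, … is generated epoch by epoch: y_{n+1} is obtained from y_n by q steps of the form x ↦ x − v/(2L) in which every gradient estimate v satisfies ‖v − ∇f(x)‖² ≤ 2^{−n−2}·M_0/τ. Then for every n, f(y_n) − f(x*) ≤ 2^{−n}·M_0. -/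
/-- The descent lemma: a function with `L`-Lipschitz gradient lies below its quadratic upper
model. -/
theorem le_quadratic_of_lipschitz_gradient
    {E : Type*} [NormedAddCommGroup E] [InnerProductSpace ℝ E]
    {f : E → ℝ} {f' : E → E} {L : ℝ}
    (hdiff : ∀ x, HasFDerivAt f (innerSL ℝ (f' x)) x)
    (hlip : ∀ x y, ‖f' x - f' y‖ ≤ L * ‖x - y‖) (x d : E) :
    f (x + d) ≤ f x + inner ℝ (f' x) d + L / 2 * ‖d‖ ^ 2 := by
  set g : ℝ → ℝ := fun t ↦ f (x + t • d) - t * inner ℝ (f' x) d - L / 2 * t ^ 2 * ‖d‖ ^ 2 with hg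
  have hderiv (t : ℝ) : HasDerivAt g
      (inner ℝ (f' (x + t • d)) d - inner ℝ (f' x) d - L * t * ‖d‖ ^ 2) t := by
    have hline : HasDerivAt (fun t : ℝ ↦ x + t • d) d t := by
      simpa using ((hasDerivAt_id t).smul_const d).const_add x
    have hf : HasDerivAt (fun t : ℝ ↦ f (x + t • d)) (inner ℝ (f' (x + t • d)) d) t := by
      simpa [Function.comp_def] using (hdiff (x + t • d)).comp_hasDerivAt t hline
    have hlin := (hasDerivAt_id t).mul_const (inner ℝ (f' x) d)
    have hsq := (((hasDerivAt_id t).pow 2).const_mul (L / 2)).mul_const (‖d‖ ^ 2)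
    refine ((hf.sub hlin).sub hsq).congr_deriv ?_
    simp only [id_eq, Nat.cast_ofNat]
    ring
  have hanti : AntitoneOn g (Set.Icc 0 1) := by
    refine antitoneOn_of_deriv_nonpos (convex_Icc 0 1)
      (fun t _ ↦ (hderiv t).continuousAt.continuousWithinAt)
      (fun t _ ↦ (hderiv t).differentiableAt.differentiableWithinAt) fun t ht ↦ ?_
    rw [interior_Icc] at ht
    rw [(hderiv t).deriv, ← inner_sub_left]
    have hinner : inner ℝ (f' (x + t • d) - f' x) d ≤ L * t * ‖d‖ ^ 2 :=
      calc inner ℝ (f' (x + t • d) - f' x) d ≤ ‖f' (x + t • d) - f' x‖ * ‖d‖ :=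
            real_inner_le_norm _ _
        _ ≤ L * ‖x + t • d - x‖ * ‖d‖ := by gcongr; exact hlip _ _
        _ = L * t * ‖d‖ ^ 2 := by
            rw [add_sub_cancel_left, norm_smul, Real.norm_of_nonneg ht.1.le]; ring
    linarith
  have h := hanti (Set.left_mem_Icc.2 zero_le_one) (Set.right_mem_Icc.2 zero_le_one) zero_le_one
  simp only [hg, one_smul, zero_smul, add_zero] at h
  linarith

/-- One inexact gradient step of length `1 / (2 * L)` decreases the objective by a multiple of
the squared gradient norm, up to the squared error of the gradient estimate. -/
theorem inexact_gradient_step_le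
    {E : Type*} [NormedAddCommGroup E] [InnerProductSpace ℝ E]
    {f : E → ℝ} {f' : E → E} {L : ℝ} (hL : 0 < L)
    (hdiff : ∀ x, HasFDerivAt f (innerSL ℝ (f' x)) x)
    (hlip : ∀ x y, ‖f' x - f' y‖ ≤ L * ‖x - y‖) (x v : E) :
    f (x - (1 / (2 * L)) • v) ≤
      f x - 1 / (4 * L) * ‖f' x‖ ^ 2 + 1 / (4 * L) * ‖v - f' x‖ ^ 2 := by
  have h := le_quadratic_of_lipschitz_gradient hdiff hlip x (-((1 / (2 * L)) • v))
  rw [← sub_eq_add_neg, inner_neg_right, real_inner_smul_right, norm_neg, norm_smul, mul_pow,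
    Real.norm_eq_abs, sq_abs] at h
  have hsub := norm_sub_sq_real v (f' x)
  rw [real_inner_comm] at hsub
  have hmodel : -(1 / (2 * L) * inner ℝ (f' x) v) + L / 2 * ((1 / (2 * L)) ^ 2 * ‖v‖ ^ 2) =
      -(1 / (4 * L) * ‖f' x‖ ^ 2) + 1 / (4 * L) * ‖v - f' x‖ ^ 2 - 1 / (8 * L) * ‖v‖ ^ 2 := by
    rw [hsub]
    field_simp
    ring
  have hnonneg : 0 ≤ 1 / (8 * L) * ‖v‖ ^ 2 := by positivity
  linarith

/-- Iterating an affine contraction inequality with fixed point `c`. -/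
theorem sub_le_pow_mul_sub_of_affine_contraction {u : ℕ → ℝ} {r c : ℝ} {q : ℕ} (hr : 0 ≤ r)
    (hu : ∀ k < q, u (k + 1) - c ≤ r * (u k - c)) :
    u q - c ≤ r ^ q * (u 0 - c) := by
  simpa using le_geom (u := fun k ↦ u k - c) hr q hu

theorem one_sub_inv_pow_le_quarter {κ : ℝ} (hκ : 1 ≤ κ) {q : ℕ} (hq : κ * Real.log 4 ≤ q) :
    (1 - κ⁻¹) ^ q ≤ 1 / 4 := by
  have hκ0 : 0 < κ := by linarith
  calc (1 - κ⁻¹) ^ q ≤ Real.exp (-κ⁻¹) ^ q :=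
        pow_le_pow_left₀ (sub_nonneg.2 (inv_le_one_of_one_le₀ hκ)) (Real.one_sub_le_exp_neg _) q
    _ = Real.exp (-(κ⁻¹ * q)) := by rw [← Real.exp_nat_mul]; ring_nf
    _ ≤ Real.exp (-Real.log 4) := by
        gcongr
        rwa [inv_mul_eq_div, le_div_iff₀' hκ0]
    _ = 1 / 4 := by rw [Real.exp_neg, Real.exp_log (by norm_num)]; norm_num

/-- Let `E` be a real inner product space and `f : E → ℝ`
differentiable with `L`-Lipschitz gradient `f'` (`L > 0`). Assume `f` is
`τ`-gradient dominated with global minimizer `x*`, and that `4Lτ ≥ 1`.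
Fix `M₀ ≥ f(x₀) − f(x*)` and a natural number `q ≥ 4Lτ·log 4`. Suppose
`y_0 = x_0, y_1, y_2, …` is generated epoch by epoch: `y_{n+1}` is obtained
from `y_n` by `q` steps of the form `x ↦ x − v/(2L)` in which every gradient
estimate `v` satisfies `‖v − ∇f(x)‖² ≤ 2^{−n−2} M₀/τ`. Then for every `n`,
`f(y_n) − f(x*) ≤ 2^{−n} M₀`. -/
theorem stmt_8
    {E : Type*} [NormedAddCommGroup E] [InnerProductSpace ℝ E]
    (f : E → ℝ) (f' : E → E) (L τ : ℝ) (hL : 0 < L) (hτ : 0 < τ)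
    (hdiff : ∀ x, HasFDerivAt f (innerSL ℝ (f' x)) x)
    (hlip : ∀ x y, ‖f' x - f' y‖ ≤ L * ‖x - y‖)
    (xstar : E) (hmin : ∀ y, f xstar ≤ f y)
    (hdom : ∀ x, f x - f xstar ≤ τ * ‖f' x‖ ^ 2)
    (hκ : 1 ≤ 4 * L * τ)
    (x₀ : E) (M₀ : ℝ) (hM₀ : f x₀ - f xstar ≤ M₀)
    (q : ℕ) (hq : 4 * L * τ * Real.log 4 ≤ q)
    (y : ℕ → E) (hy0 : y 0 = x₀)
    (hepoch : ∀ n : ℕ, ∃ z v : ℕ → E, z 0 = y n ∧ z q = y (n + 1) ∧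
      (∀ k < q, z (k + 1) = z k - (1 / (2 * L)) • v k) ∧
      (∀ k < q, ‖v k - f' (z k)‖ ^ 2 ≤ (1 / 2 : ℝ) ^ (n + 2) * M₀ / τ)) :
    ∀ n : ℕ, f (y n) - f xstar ≤ (1 / 2 : ℝ) ^ n * M₀ := by
  have hM₀_nonneg : 0 ≤ M₀ := by linarith [hmin x₀]
  have hr : 0 ≤ 1 - (4 * L * τ)⁻¹ := sub_nonneg.2 (inv_le_one_of_one_le₀ hκ)
  intro n
  induction n with
  | zero => simpa [hy0] using hM₀
  | succ n ih =>
    obtain ⟨z, v, hz0, hzq, hstep, herr⟩ := hepoch n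
    set m : ℝ := (1 / 2 : ℝ) ^ n * M₀ with hm
    have hm_nonneg : 0 ≤ m := by positivity
    have hcontract : ∀ k < q, f (z (k + 1)) - f xstar - m / 4 ≤
        (1 - (4 * L * τ)⁻¹) * (f (z k) - f xstar - m / 4) := fun k hk ↦ by
      have hdescent := inexact_gradient_step_le hL hdiff hlip (z k) (v k)
      rw [← hstep k hk] at hdescent
      have hgrad : (4 * L * τ)⁻¹ * (f (z k) - f xstar) ≤ 1 / (4 * L) * ‖f' (z k)‖ ^ 2 :=
        calc (4 * L * τ)⁻¹ * (f (z k) - f xstar)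
            ≤ (4 * L * τ)⁻¹ * (τ * ‖f' (z k)‖ ^ 2) := by gcongr; exact hdom _
          _ = 1 / (4 * L) * ‖f' (z k)‖ ^ 2 := by field_simp
      have hnoise : 1 / (4 * L) * ‖v k - f' (z k)‖ ^ 2 ≤ (4 * L * τ)⁻¹ * (m / 4) :=
        calc 1 / (4 * L) * ‖v k - f' (z k)‖ ^ 2
            ≤ 1 / (4 * L) * ((1 / 2 : ℝ) ^ (n + 2) * M₀ / τ) := by gcongr; exact herr k hk
          _ = (4 * L * τ)⁻¹ * (m / 4) := by rw [hm, pow_add]; field_simp; norm_num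
      linarith
    have hiter := sub_le_pow_mul_sub_of_affine_contraction
      (u := fun k ↦ f (z k) - f xstar) hr hcontract
    simp only [hz0, hzq] at hiter
    have hbound : (1 - (4 * L * τ)⁻¹) ^ q * (f (y n) - f xstar - m / 4) ≤ 1 / 4 * (3 / 4 * m) :=
      calc (1 - (4 * L * τ)⁻¹) ^ q * (f (y n) - f xstar - m / 4)
          ≤ (1 - (4 * L * τ)⁻¹) ^ q * (3 / 4 * m) := by gcongr; linarith
        _ ≤ 1 / 4 * (3 / 4 * m) := by gcongr; exact one_sub_inv_pow_le_quarter hκ hq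
    have hhalf : (1 / 2 : ℝ) ^ (n + 1) * M₀ = m / 2 := by rw [hm, pow_succ]; ring
    linarith
end
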